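/- Let a > 0, k ≥ 1 an integer, and ω ∈ ℝ. Then the function w ↦ e^{−iωw}/(w − ia)^{k+1} is integrable on ℝ and ∫_ℝ e^{−iωw} (w − ia)^{−(k+1)} dw = 2π i^{k+1} ((−ω)^k / k!) e^{aω} 1_{(−∞,0)}(ω). -/

import Mathlib

open MeasureTheory

open Filter Topology FourierTransform in
lemma aux_int (s : ℂ) (hs : 0 < s.re) (n : ℕ) :
    IntegrableOn (fun t : ℝ => (t : ℂ) ^ n * Complex.exp (-s * t)) (Set.Ioi 0) := by
  have h := integrableOn_rpow_mul_exp_neg_mul_rpow (p := 1) (s := n) (b := s.re)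
    (by have : (0:ℝ) ≤ n := n.cast_nonneg
        linarith) one_pos hs
  refine Integrable.mono' h ?_ ?_
  · exact (by fun_prop : Continuous fun t : ℝ => (t : ℂ) ^ n * Complex.exp (-s * t)).aestronglyMeasurable
  · filter_upwards [ae_restrict_mem measurableSet_Ioi] with t ht
    have ht' : (0:ℝ) < t := ht
    simp [Complex.norm_exp, abs_of_pos ht']

open Filter Topology FourierTransform in
lemma aux_tend (s : ℂ) (hs : 0 < s.re) (n : ℕ) :
    Tendsto (fun t : ℝ => (t : ℂ) ^ n * Complex.exp (-s * t)) atTop (𝓝 0) := by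
  rw [tendsto_zero_iff_norm_tendsto_zero]
  refine (tendsto_rpow_mul_exp_neg_mul_atTop_nhds_zero n s.re hs).congr' ?_
  filter_upwards [eventually_gt_atTop 0] with t ht
  simp [Complex.norm_exp, abs_of_pos ht]

open Filter Topology FourierTransform in
lemma aux_val (s : ℂ) (hs : 0 < s.re) (n : ℕ) :
    ∫ t in Set.Ioi (0:ℝ), (t : ℂ) ^ n * Complex.exp (-s * t) = n.factorial / s ^ (n + 1) := by
  have hs0 : s ≠ 0 := by rintro rfl; simp at hs
  induction n with
  | zero =>
    have := integral_exp_mul_complex_Ioi (a := -s) (by simpa using hs) 0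
    simp at this ⊢
    rw [this]
  | succ n ih =>
    have hd : ∀ x ∈ Set.Ici (0:ℝ), HasDerivAt (fun t : ℝ => (t : ℂ) ^ (n+1) * Complex.exp (-s * t))
        (((n+1 : ℕ) : ℂ) * ((x : ℂ) ^ n * Complex.exp (-s * x))
          - s * ((x : ℂ) ^ (n+1) * Complex.exp (-s * x))) x := by
      intro x _
      have h1 : HasDerivAt (fun z : ℂ => z ^ (n+1) * Complex.exp (-s * z))
        (((n+1 : ℕ) : ℂ) * ((x : ℂ) ^ n * Complex.exp (-s * x))
          - s * ((x : ℂ) ^ (n+1) * Complex.exp (-s * x))) (x : ℂ) := by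
        have := (hasDerivAt_pow (n+1) (x:ℂ)).mul (((hasDerivAt_id (x:ℂ)).const_mul (-s)).cexp)
        refine this.congr_deriv ?_
        simp only [id, Nat.add_sub_cancel]
        ring
      exact h1.comp_ofReal
    have i1 := (aux_int s hs n).const_mul ((n+1 : ℕ) : ℂ)
    have i2 := (aux_int s hs (n+1)).const_mul s
    have key := integral_Ioi_of_hasDerivAt_of_tendsto' hd (i1.sub i2) (aux_tend s hs (n+1))
    rw [integral_sub i1 i2, integral_const_mul, integral_const_mul, ih] at key
    simp at key
    rw [Nat.factorial_succ]
    push_cast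
    simp only [neg_mul]
    generalize (∫ t in Set.Ioi (0:ℝ), (t : ℂ) ^ (n+1) * Complex.exp (-(s * t))) = J at *
    have : s * J = (n+1) * (n.factorial / s^(n+1)) := by linear_combination -key
    rw [eq_div_iff (by positivity)]
    field_simp at this
    linear_combination this

lemma aux_integrable (a : ℝ) (ha : 0 < a) (k : ℕ) (hk : 1 ≤ k) (ω : ℝ) :
    Integrable (fun w : ℝ =>
      Complex.exp (-Complex.I * ω * w) / ((w : ℂ) - Complex.I * a) ^ (k + 1)) := by
  have hne : ∀ w : ℝ, (w : ℂ) - Complex.I * a ≠ 0 := by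
    intro w h
    have := congrArg Complex.im h
    simp at this
    exact ha.ne' this
  have h1 : Integrable fun w : ℝ => ((a⁻¹)^(k+1)) * (1 + (a⁻¹ * w)^2)⁻¹ :=
    (integrable_inv_one_add_sq.comp_mul_left' (inv_ne_zero ha.ne')).const_mul _
  refine h1.mono' ?_ ?_
  · refine Continuous.aestronglyMeasurable ?_
    exact Continuous.div (by fun_prop) (by fun_prop) (fun w => pow_ne_zero _ (hne w))
  · refine Filter.Eventually.of_forall fun w => ?_
    have e : Complex.exp (-Complex.I * ω * w) = Complex.exp (((-ω * w : ℝ) : ℂ) * Complex.I) := by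
      congr 1; push_cast; ring
    rw [norm_div, e, Complex.norm_exp_ofReal_mul_I, norm_pow]
    set N := ‖(w : ℂ) - Complex.I * a‖ with hN
    have hN2 : N ^ 2 = w^2 + a^2 := by
      rw [hN, ← Complex.normSq_eq_norm_sq, Complex.normSq_apply]; simp; ring
    have hNa : a ≤ N := by
      apply le_of_sq_le_sq _ (norm_nonneg _) <;> nlinarith [sq_nonneg w]
    obtain ⟨j, rfl⟩ : ∃ j, k = j + 1 := ⟨k - 1, by omega⟩
    have hp : a ^ j ≤ N ^ j := pow_le_pow_left₀ ha.le hNa j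
    have : a⁻¹^(j+1+1) * (1 + (a⁻¹ * w)^2)⁻¹ = 1 / (a^j * (w^2+a^2)) := by
      rw [inv_pow]
      field_simp
      ring
    rw [this]
    have : N^(j+1+1) = N^j * (w^2+a^2) := by rw [← hN2]; ring
    rw [this]
    gcongr

open FourierTransform in
theorem stmt3 (a : ℝ) (ha : 0 < a) (k : ℕ) (hk : 1 ≤ k) (ω : ℝ) :
    Integrable (fun w : ℝ =>
      Complex.exp (-Complex.I * ω * w) / ((w : ℂ) - Complex.I * a) ^ (k + 1)) ∧
    (∫ w : ℝ, Complex.exp (-Complex.I * ω * w) / ((w : ℂ) - Complex.I * a) ^ (k + 1)) =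
      (2 * Real.pi : ℝ) * Complex.I ^ (k + 1) *
        (((-ω) ^ k / (Nat.factorial k) * Real.exp (a * ω) *
          Set.indicator (Set.Iio (0 : ℝ)) (fun _ => (1 : ℝ)) ω : ℝ) : ℂ) := by
  refine ⟨aux_integrable a ha k hk ω, ?_⟩
  have hk0 : k ≠ 0 := by omega
  have hpi := Real.pi_pos
  let g : ℝ → ℂ := fun t => ((max t 0 : ℝ) : ℂ) ^ k * Complex.exp (-(a:ℂ) * t)
  have hgc : Continuous g := by fun_prop
  have hgi : g = Set.indicator (Set.Ioi 0) (fun t : ℝ => (t : ℂ) ^ k * Complex.exp (-(a:ℂ) * t)) := by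
    ext t
    by_cases ht : 0 < t
    · simp [g, ht, max_eq_left ht.le]
    · simp [g, ht, max_eq_right (not_lt.mp ht), hk0]
  have hgint : Integrable g := by
    rw [hgi, integrable_indicator_iff measurableSet_Ioi]
    exact aux_int a (by simpa using ha) k
  have hF : 𝓕 g = fun v : ℝ => ((k.factorial : ℂ) / Complex.I ^ (k+1)) *
      (Complex.exp (-Complex.I * (0:ℝ) * (2 * Real.pi * v : ℝ)) /
        (((2 * Real.pi * v : ℝ) : ℂ) - Complex.I * a) ^ (k + 1)) := by
    ext v
    rw [Real.fourier_real_eq_integral_exp_smul]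
    have hv := aux_val (a + 2 * Real.pi * v * Complex.I) (by simpa using ha) k
    have e : (fun t : ℝ => Complex.exp (↑(-2 * Real.pi * t * v) * Complex.I) • g t) =
        Set.indicator (Set.Ioi 0) (fun t : ℝ => (t : ℂ) ^ k *
          Complex.exp (-((a:ℂ) + 2 * Real.pi * v * Complex.I) * t)) := by
      ext t
      rw [hgi]
      by_cases ht : 0 < t
      · simp only [Set.mem_Ioi, ht, Set.indicator_of_mem, smul_eq_mul]
        rw [mul_left_comm, ← Complex.exp_add]
        congr 2
        push_cast; ring
      · simp [ht]
    rw [e, integral_indicator measurableSet_Ioi, hv]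
    have : (a:ℂ) + 2 * Real.pi * v * Complex.I =
        Complex.I * (((2 * Real.pi * v : ℝ) : ℂ) - Complex.I * a) := by
      push_cast
      linear_combination (a:ℂ) * Complex.I_mul_I
    rw [this, mul_pow]
    simp [div_eq_mul_inv]
    ring
  have hFi : Integrable (𝓕 g) := by
    rw [hF]
    exact ((aux_integrable a ha k hk 0).comp_mul_left' (by positivity : 2 * Real.pi ≠ 0)).const_mul _
  have inv := congrFun (hgc.fourierInv_fourier_eq hgint hFi) (-ω)
  rw [Real.fourierInv_eq', hF] at inv
  have e2 : (fun v : ℝ => Complex.exp (↑(2 * Real.pi * inner ℝ v (-ω)) * Complex.I) •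
     (((k.factorial : ℂ) / Complex.I ^ (k+1)) *
      (Complex.exp (-Complex.I * (0:ℝ) * (2 * Real.pi * v : ℝ)) /
        (((2 * Real.pi * v : ℝ) : ℂ) - Complex.I * a) ^ (k + 1)))) =
      fun v : ℝ => ((k.factorial : ℂ) / Complex.I ^ (k+1)) *
       (fun w : ℝ => Complex.exp (-Complex.I * ω * w) / ((w : ℂ) - Complex.I * a) ^ (k + 1))
        (2 * Real.pi * v) := by
    ext v
    have : Complex.exp (↑(2 * Real.pi * inner ℝ v (-ω)) * Complex.I) =
      Complex.exp (-Complex.I * ω * (2 * Real.pi * v : ℝ)) := by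
      congr 1
      simp
      ring
    rw [this]
    simp
    ring
  rw [e2, integral_const_mul, Measure.integral_comp_mul_left
    (fun w : ℝ => Complex.exp (-Complex.I * ω * w) / ((w : ℂ) - Complex.I * a) ^ (k + 1))] at inv
  generalize (∫ w : ℝ, Complex.exp (-Complex.I * ω * w) / ((w : ℂ) - Complex.I * a) ^ (k + 1)) = J at *
  have hg : g (-ω) = (((-ω) ^ k * Real.exp (a * ω) *
          Set.indicator (Set.Iio (0 : ℝ)) (fun _ => (1 : ℝ)) ω : ℝ) : ℂ) := by
    rw [hgi]
    by_cases h : ω < 0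
    · simp [h]
    · simp [h]
  rw [hg, abs_of_pos (by positivity), Complex.real_smul] at inv
  have hkf : (k.factorial : ℂ) ≠ 0 := by exact_mod_cast k.factorial_ne_zero
  have hpc : (Real.pi : ℂ) ≠ 0 := by exact_mod_cast hpi.ne'
  have hI : Complex.I ^ (k+1) ≠ 0 := pow_ne_zero _ Complex.I_ne_zero
  generalize Set.indicator (Set.Iio (0 : ℝ)) (fun _ => (1 : ℝ)) ω = c at *
  generalize Complex.I ^ (k+1) = d at *
  push_cast at inv ⊢
  field_simp at inv ⊢
  linear_combination inv
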